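/- arXiv:2406.06350 — 2 statements merged into one kernel-verified Lean document; each statement's English description precedes it below -/
import Mathlib

section
/- Given an architectural vector l₁ = (l_0, l_1, …, l_{L−1}, l_L) with l_L = 1, define l₂ = (l_0, l_1, …, l_{L−1}, n, l_L) for any integer n ≥ 1 (i.e., append a new hidden layer of width n before the output layer). Then for any domain D ⊂ ℝ^{l_0} and any activation function σ, the representation capacity satisfies U(D, l₁, σ) ⊆ U(D, l₂, σ). -/
open MeasureTheory

noncomputable section

/-- Weights and biases of a feed-forward neural network with layer widths `l k`. -/
structure FNNParams (l : ℕ → ℕ) : Type where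
  W : (k : ℕ) → Matrix (Fin (l (k+1))) (Fin (l k)) ℝ
  b : (k : ℕ) → Fin (l (k+1)) → ℝ

/-- Output of the `k`-th hidden layer (activation `σ` in every hidden layer). -/
def hiddenOut (σ : ℝ → ℝ) (l : ℕ → ℕ) (θ : FNNParams l) :
    (k : ℕ) → (Fin (l 0) → ℝ) → Fin (l k) → ℝ
  | 0, x => x
  | (k+1), x => fun j => σ ((∑ m, θ.W k j m * hiddenOut σ l θ k x m) + θ.b k j)

/-- Output of a scalar hidden-layer concatenated FNN with layers `0, 1, …, L`
(hidden layers `1, …, L−1`):  `u_θ(z) = ∑_{i=1}^{L−1} M_i u_i^ϑ(z) + b_L`. -/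
def hlconcOut (σ : ℝ → ℝ) (l : ℕ → ℕ) (L : ℕ) (θ : FNNParams l)
    (M : (i : ℕ) → Fin (l i) → ℝ) (bL : ℝ) (x : Fin (l 0) → ℝ) : ℝ :=
  (∑ i ∈ Finset.Icc 1 (L - 1), ∑ m, M i m * hiddenOut σ l θ i x m) + bL

/-- `U(D, l, σ)`: the representation capacity of the HLConcFNN with architecture
`(l 0, …, l L)` (input dimension `l 0 = dIn`) and activation `σ` on the domain `D`;
the set of all functions on `D` that are outputs of the network. -/
def Urep (dIn : ℕ) (D : Set (Fin dIn → ℝ)) (σ : ℝ → ℝ) (l : ℕ → ℕ) (L : ℕ)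
    (hl : l 0 = dIn) : Set ((Fin dIn → ℝ) → ℝ) :=
  {g | ∃ (θ : FNNParams l) (M : (i : ℕ) → Fin (l i) → ℝ) (bL : ℝ),
        ∀ x ∈ D, g x = hlconcOut σ l L θ M bL (fun j => x (Fin.cast hl j))}

/-- If the widths of `l'` and `l` agree up to layer `K`, the parameters of the first `K` layers for
`l` give parameters for `l'`, extended by zero in all later layers. -/
def FNNParams.extendByZero {l l' : ℕ → ℕ} {K : ℕ} (hagree : ∀ j, j ≤ K → l' j = l j)
    (θ : FNNParams l) : FNNParams l' where
  W k i j := if h : k + 1 ≤ K then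
    θ.W k (Fin.cast (hagree (k + 1) h) i) (Fin.cast (hagree k (Nat.le_of_succ_le h)) j) else 0
  b k i := if h : k + 1 ≤ K then θ.b k (Fin.cast (hagree (k + 1) h) i) else 0

/-- Sums over `Fin` are invariant under casting the index type. -/
lemma sum_fin_cast {m n : ℕ} (h : m = n) (f : Fin n → ℝ) :
    ∑ i, f (Fin.cast h i) = ∑ i, f i := by
  subst h
  rfl

/-- Extending the parameters by zero leaves the first `K` layers unchanged. -/
lemma hiddenOut_extendByZero (σ : ℝ → ℝ) {l l' : ℕ → ℕ} {K : ℕ}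
    (hagree : ∀ j, j ≤ K → l' j = l j) (θ : FNNParams l) (x : Fin (l 0) → ℝ) (k : ℕ)
    (hk : k ≤ K) (i : Fin (l' k)) :
    hiddenOut σ l' (θ.extendByZero hagree) k
        (fun j => x (Fin.cast (hagree 0 (Nat.zero_le K)) j)) i =
      hiddenOut σ l θ k x (Fin.cast (hagree k hk) i) := by
  induction k with
  | zero => rfl
  | succ k ih =>
    have hk' : k ≤ K := Nat.le_of_succ_le hk
    simp only [hiddenOut, FNNParams.extendByZero, dif_pos hk]
    congr 2
    rw [← sum_fin_cast (hagree k hk')]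
    exact Finset.sum_congr rfl fun j _ => congrArg _ (ih hk' j)

/-- Lemma A.5.  Appending a new hidden layer of width `n ≥ 1` before
the output layer (architecture `l₁ = (l_0, …, l_{L−1}, 1)` becoming
`l₂ = (l_0, …, l_{L−1}, n, 1)`) does not decrease the representation capacity of a
hidden-layer concatenated FNN, for any domain `D` and any activation `σ`. -/
theorem hlconc_append_layer_capacity
    (dIn L n : ℕ) (hL : 2 ≤ L) (hn : 1 ≤ n)
    (l₁ l₂ : ℕ → ℕ) (hl₁0 : l₁ 0 = dIn) (hl₂0 : l₂ 0 = dIn)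
    (hl₁L : l₁ L = 1)
    (hagree : ∀ j, j ≤ L - 1 → l₂ j = l₁ j)
    (hl₂L : l₂ L = n) (hl₂L1 : l₂ (L+1) = 1)
    (D : Set (Fin dIn → ℝ)) (σ : ℝ → ℝ) :
    Urep dIn D σ l₁ L hl₁0 ⊆ Urep dIn D σ l₂ (L+1) hl₂0 := by
  rintro g ⟨θ, M, bL, hg⟩
  refine ⟨θ.extendByZero hagree,
    fun i m => if h : i ≤ L - 1 then M i (Fin.cast (hagree i h) m) else 0, bL, fun x hx => ?_⟩
  rw [hg x hx, hlconcOut, hlconcOut, Nat.add_sub_cancel]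
  congr 1
  have hsub : Finset.Icc 1 (L - 1) ⊆ Finset.Icc 1 L :=
    Finset.Icc_subset_Icc_right (Nat.sub_le L 1)
  rw [← Finset.sum_subset hsub]
  · refine Finset.sum_congr rfl fun i hi => ?_
    have hi' : i ≤ L - 1 := (Finset.mem_Icc.mp hi).2
    rw [← sum_fin_cast (hagree i hi')]
    refine Finset.sum_congr rfl fun m _ => ?_
    rw [dif_pos hi']
    exact congrArg _ (hiddenOut_extendByZero σ hagree θ
      (fun j => x (Fin.cast hl₁0 j)) i hi' m).symm
  · intro i hi hi'
    have h : ¬ i ≤ L - 1 := fun h =>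
      hi' (Finset.mem_Icc.mpr ⟨(Finset.mem_Icc.mp hi).1, h⟩)
    simp [h]

end
end

section
/- Given an architectural vector l₁ = (l_0, l_1, …, l_{L−1}, l_L) with l_L = 1, define l₂ = (l_0, l_1, …, l_{s−1}, l_s + 1, l_{s+1}, …, l_L) for some 1 ≤ s ≤ L−1 (i.e., add one extra node to the s-th hidden layer). Then for any domain D ⊂ ℝ^{l_0} and any activation function σ, the representation capacity satisfies U(D, l₁, σ) ⊆ U(D, l₂, σ). -/
open MeasureTheory

noncomputable section

/-- Summing the extension by zero of `f` against `g` only sees the restriction of `g`. -/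
theorem sum_zeroExtend_mul {n m : ℕ} (h : n ≤ m) (f : Fin n → ℝ) (g : Fin m → ℝ) :
    ∑ i : Fin m, (if hi : i.val < n then f ⟨i, hi⟩ else 0) * g i
      = ∑ i : Fin n, f i * g (Fin.castLE h i) := by
  obtain ⟨k, rfl⟩ := Nat.exists_eq_add_of_le h
  rw [Fin.sum_univ_add]
  simp [Fin.castAdd]

/-- Extension of network parameters by zero to an architecture `l₂`. -/
def FNNParams.zeroExtend {l₁ : ℕ → ℕ} (l₂ : ℕ → ℕ) (θ : FNNParams l₁) : FNNParams l₂ where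
  W k j m := if hm : m.val < l₁ k then
      (if hj : j.val < l₁ (k + 1) then θ.W k ⟨j, hj⟩ ⟨m, hm⟩ else 0) else 0
  b k j := if hj : j.val < l₁ (k + 1) then θ.b k ⟨j, hj⟩ else 0

/-- The original nodes of a zero-extended network keep their outputs. -/
theorem hiddenOut_zeroExtend (σ : ℝ → ℝ) {l₁ l₂ : ℕ → ℕ} (hle : ∀ k, l₁ k ≤ l₂ k)
    (θ : FNNParams l₁) (x : Fin (l₂ 0) → ℝ) (k : ℕ) (j : Fin (l₁ k)) :
    hiddenOut σ l₂ (θ.zeroExtend l₂) k x (Fin.castLE (hle k) j)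
      = hiddenOut σ l₁ θ k (fun i => x (Fin.castLE (hle 0) i)) j := by
  induction k with
  | zero => rfl
  | succ k ih =>
    have hsum := sum_zeroExtend_mul (hle k) (fun m => θ.W k j m)
      (hiddenOut σ l₂ (θ.zeroExtend l₂) k x)
    simp only [ih] at hsum
    simp [hiddenOut, FNNParams.zeroExtend, ← hsum]

/-- Lemma A.6.  Adding one extra node to the `s`-th hidden layer
(`1 ≤ s ≤ L−1`, architecture `l₁ = (l_0, …, l_{L−1}, 1)` becoming
`l₂ = (l_0, …, l_{s−1}, l_s + 1, l_{s+1}, …, 1)`) does not decrease the representation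
capacity of a hidden-layer concatenated FNN, for any domain `D` and any activation `σ`. -/
theorem hlconc_widen_layer_capacity
    (dIn L s : ℕ) (hL : 2 ≤ L) (hs1 : 1 ≤ s) (hsL : s ≤ L - 1)
    (l₁ l₂ : ℕ → ℕ) (hl₁0 : l₁ 0 = dIn) (hl₂0 : l₂ 0 = dIn)
    (hl₁L : l₁ L = 1)
    (hagree : ∀ j, j ≠ s → l₂ j = l₁ j)
    (hl₂s : l₂ s = l₁ s + 1)
    (D : Set (Fin dIn → ℝ)) (σ : ℝ → ℝ) :
    Urep dIn D σ l₁ L hl₁0 ⊆ Urep dIn D σ l₂ L hl₂0 := by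
  have hle : ∀ k, l₁ k ≤ l₂ k := fun k => by
    by_cases hk : k = s
    · subst hk
      omega
    · exact (hagree k hk).ge
  rintro g ⟨θ, M, bL, hg⟩
  refine ⟨θ.zeroExtend l₂, fun i m => if hm : m.val < l₁ i then M i ⟨m, hm⟩ else 0, bL,
    fun x hx => ?_⟩
  rw [hg x hx]
  simp only [hlconcOut, sum_zeroExtend_mul (hle _), hiddenOut_zeroExtend σ hle]
  rfl

end
end
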